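/- arXiv:1008.1987 — 2 statements merged into one kernel-verified Lean document; each statement's English description precedes it below -/
import Mathlib

section
/- Let n ≥ 4 be even and let F be a field of characteristic ≠ 2. There is an injective linear map i from the simple n-Lie algebra L_{n+1} into an associative algebra A such that i([z_1,...,z_n]) = Σ_{σ∈S_n} ε(σ) i(z_{σ(1)})⋯i(z_{σ(n)}) for all z_1,...,z_n ∈ L_{n+1}; that is, L_{n+1} embeds as a subalgebra of the alternating n-ary minus algebra A⁻ of some associative algebra A. -/
/-- The bracket of the simple `n`-Lie algebra `L_{n+1}`: the multilinear extension of
`[e_1, ..., ê_i, ..., e_{n+1}] = (-1)^{n+i+1} e_i` (with `0`-indexed basis vectors the sign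
is `(-1)^{n+i}`). -/
noncomputable def simpleBracket (F : Type) [Field F] (n : ℕ)
    (v : Fin n → (Fin (n + 1) → F)) : Fin (n + 1) → F :=
  ∑ i : Fin (n + 1),
    ((-1 : F) ^ (n + (i : ℕ)) *
      Matrix.det (Matrix.of fun k l : Fin n => v k (i.succAbove l))) •
        (Pi.single i 1 : Fin (n + 1) → F)

open Matrix in
/-- The representing matrices: `x_a = ε E_{a,a+1} + E_{a+1,a}`, indexed by `ℤ/N`. -/
def cycX (F : Type) [Field F] (N : ℕ) (ε : F) (a : ZMod N) : Matrix (ZMod N) (ZMod N) F :=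
  single a (a + 1) ε + single (a + 1) a 1

lemma zmod_small (N : ℕ) (k : ℕ) (h0 : 0 < k) (h : k < N) : (k : ZMod N) ≠ 0 := by
  intro h'
  rw [ZMod.natCast_eq_zero_iff] at h'
  exact absurd (Nat.le_of_dvd h0 h') (by omega)

lemma cyc_facts (N : ℕ) (h : 3 ≤ N) : (1 : ZMod N) ≠ 0 ∧ (2 : ZMod N) ≠ 0 := by
  refine ⟨?_, ?_⟩
  · have := zmod_small N 1 (by omega) (by omega); simpa using this
  · have := zmod_small N 2 (by omega) (by omega); simpa using this

open Matrix in
lemma cycX_mul_zero (F : Type) [Field F] (N : ℕ) [NeZero N] (ε : F) (a b : ZMod N)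
    (h0 : a ≠ b) (h1 : b ≠ a + 1) (h2 : b ≠ a - 1) :
    cycX F N ε a * cycX F N ε b = 0 := by
  have e1 : a + 1 ≠ b + 1 := fun h => h0 (add_right_cancel h)
  have e2 : a ≠ b + 1 := fun h => h2 (by rw [h]; ring)
  simp [cycX, add_mul, mul_add, single_mul_single_of_ne, h0, h1.symm, e1, e2]

open Matrix in
lemma cyc_fwd (F : Type) [Field F] (N : ℕ) [NeZero N] (h3 : 3 ≤ N) (ε : F) (a : ZMod N) (m : ℕ) :
    (List.ofFn fun k : Fin (m + 2) => cycX F N ε (a + (k : ℕ))).prod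
      = single a (a + (m + 2 : ℕ)) (ε ^ (m + 2)) := by
  obtain ⟨h1, h2⟩ := cyc_facts N h3
  induction m with
  | zero =>
    have e1 : a + 1 ≠ a + 1 + 1 := by simp [h1]
    have e2 : a ≠ a + 1 := by simp [h1]
    have e3 : a ≠ a + 1 + 1 := by
      intro h; apply h2; linear_combination -h
    have e4 : a + 1 + 1 = a + 2 := by ring
    simp [List.ofFn_succ, cycX, add_mul, mul_add, single_mul_single_of_ne, e1, e2, e3]
    rw [e4, pow_two]
  | succ m ih =>
    rw [List.ofFn_succ', List.concat_eq_append, List.prod_append]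
    simp only [Fin.val_castSucc, Fin.val_last, List.prod_singleton]
    rw [ih]
    have e1 : a + ((m + 2 : ℕ) : ZMod N) ≠ a + ((m + 2 : ℕ) : ZMod N) + 1 := by simp [h1]
    rw [cycX, mul_add, single_mul_single_same, single_mul_single_of_ne _ _ _ _ e1, add_zero]
    congr 1
    · push_cast; ring
    · ring

open Matrix in
lemma cyc_bwd (F : Type) [Field F] (N : ℕ) [NeZero N] (h3 : 3 ≤ N) (ε : F) (a : ZMod N) (m : ℕ) :
    (List.ofFn fun k : Fin (m + 2) => cycX F N ε (a - (k : ℕ))).prod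
      = single (a + 1) (a + 1 - (m + 2 : ℕ)) 1 := by
  obtain ⟨h1, h2⟩ := cyc_facts N h3
  induction m with
  | zero =>
    have e1 : a + 1 ≠ a := by simp [h1]
    have e2 : a ≠ a - 1 := by intro h; apply h1; linear_combination h
    have e3 : a + 1 ≠ a - 1 := by
      intro h; apply h2; linear_combination h
    have e4 : a + 1 - 2 = a - 1 := by ring
    simp [List.ofFn_succ, cycX, add_mul, mul_add, single_mul_single_of_ne, e1, e2, e3, e4]
  | succ m ih =>
    rw [List.ofFn_succ', List.concat_eq_append, List.prod_append]
    simp only [Fin.val_castSucc, Fin.val_last, List.prod_singleton]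
    rw [ih]
    have e0 : a + 1 - ((m + 2 : ℕ) : ZMod N) = a - ((m + 2 : ℕ) : ZMod N) + 1 := by ring
    have e1 : a - ((m + 2 : ℕ) : ZMod N) + 1 ≠ a - ((m + 2 : ℕ) : ZMod N) := by simp [h1]
    rw [e0, cycX, mul_add, single_mul_single_same, single_mul_single_of_ne _ _ _ _ e1, zero_add]
    congr 1
    · push_cast; ring
    · ring

lemma prod_ofFn_zero {A : Type} [Ring A] : ∀ (n : ℕ) (f : Fin n → A) (k : ℕ) (h : k + 1 < n),
    f ⟨k, by omega⟩ * f ⟨k + 1, h⟩ = 0 → (List.ofFn f).prod = 0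
  | 0, _, _, h, _ => by omega
  | 1, _, _, h, _ => by omega
  | n + 2, f, 0, _, h0 => by
    rw [List.ofFn_succ, List.ofFn_succ, List.prod_cons, List.prod_cons, ← mul_assoc]
    have : f 0 * f (Fin.succ 0) = 0 := h0
    rw [this, zero_mul]
  | n + 2, f, k + 1, h, h0 => by
    rw [List.ofFn_succ, List.prod_cons, prod_ofFn_zero (n + 1) (fun i => f i.succ) k (by omega) h0,
      mul_zero]

/-- An injective word with consecutive letters differing by `±1` is monotone. -/
lemma word_mono (N n : ℕ) (hn : 2 ≤ n) (w : Fin n → ZMod N) (hw : Function.Injective w)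
    (h : ∀ (k : ℕ) (hk : k + 1 < n), w ⟨k + 1, hk⟩ = w ⟨k, by omega⟩ + 1 ∨
      w ⟨k + 1, hk⟩ = w ⟨k, by omega⟩ - 1) :
    (∀ k : Fin n, w k = w ⟨0, by omega⟩ + (k : ℕ)) ∨
    (∀ k : Fin n, w k = w ⟨0, by omega⟩ - (k : ℕ)) := by
  have key : ∀ s : ZMod N, (s = 1 ∨ s = -1) → w ⟨1, by omega⟩ = w ⟨0, by omega⟩ + s →
      ∀ (k : ℕ) (hk : k + 1 < n), w ⟨k + 1, hk⟩ = w ⟨k, by omega⟩ + s := by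
    intro s hs h1 k
    induction k with
    | zero => intro hk; exact h1
    | succ k ih =>
      intro hk
      have hi := ih (by omega)
      have hne : w ⟨k + 1 + 1, hk⟩ ≠ w ⟨k, by omega⟩ := by
        intro h'
        have := hw h'
        simp at this
        omega
      rcases h (k + 1) hk with h' | h' <;> rcases hs with rfl | rfl
      · exact h'
      · exact absurd (by rw [h', hi]; ring) hne
      · exact absurd (by rw [h', hi]; ring) hne
      · rw [h']; ring
  have key2 : ∀ s : ZMod N, (∀ (k : ℕ) (hk : k + 1 < n), w ⟨k + 1, hk⟩ = w ⟨k, by omega⟩ + s) →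
      ∀ (k : ℕ) (hk : k < n), w ⟨k, hk⟩ = w ⟨0, by omega⟩ + k * s := by
    intro s hs k
    induction k with
    | zero => intro hk; simp
    | succ k ih =>
      intro hk
      rw [hs k hk, ih (by omega)]; push_cast; ring
  rcases h 0 (by omega) with h' | h'
  · left
    intro k
    rw [key2 1 (key 1 (Or.inl rfl) h') k k.2]; simp
  · right
    intro k
    have := key2 (-1) (key (-1) (Or.inr rfl) (by rw [h']; ring)) k k.2
    rw [this]; ring

lemma word_start (N n : ℕ) (hN : N = n + 1) (d : ZMod N)
    (h : ∀ k : Fin n, d ≠ (k : ℕ)) : d = -1 := by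
  subst hN
  have hv := ZMod.val_lt d
  have hd : ((d.val : ℕ) : ZMod (n + 1)) = d := ZMod.natCast_zmod_val d
  have : d.val = n := by
    by_contra hne
    exact h ⟨d.val, by omega⟩ hd.symm
  rw [← hd, this]
  have : ((n + 1 : ℕ) : ZMod (n + 1)) = 0 := ZMod.natCast_self _
  push_cast at this
  linear_combination this

lemma rot_apply (n : ℕ) (j : ℕ) (k : Fin (n + 1)) :
    (((finRotate (n + 1)) ^ j) k : ℕ) = (k + j) % (n + 1) := by
  induction j with
  | zero => simp [Nat.mod_eq_of_lt k.2]
  | succ j ih =>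
    rw [pow_succ', Equiv.Perm.mul_apply, finRotate_apply, Fin.val_add, ih, Fin.val_one', ← Nat.add_mod, add_assoc]

lemma succAbove_rot (n : ℕ) (j : Fin (n + 2)) (k : Fin (n + 1)) :
    (((j.succAbove (((finRotate (n + 1)) ^ (j : ℕ)) k) : Fin (n + 2)) : ℕ) : ZMod (n + 2))
      = (j : ℕ) + 1 + (k : ℕ) := by
  have h := rot_apply n j k
  set r := ((finRotate (n + 1)) ^ (j : ℕ)) k with hr
  have hN : ((n + 2 : ℕ) : ZMod (n + 2)) = 0 := ZMod.natCast_self _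
  have hj := j.2
  have hk := k.2
  have hv : ((j.succAbove r : Fin (n + 2)) : ℕ) = if (r : ℕ) < j then (r : ℕ) else r + 1 := by
    simp only [Fin.succAbove, Fin.lt_def, Fin.val_castSucc]
    split_ifs <;> simp
  rw [hv]
  by_cases hc : (k : ℕ) + j < n + 1
  · rw [Nat.mod_eq_of_lt hc] at h
    rw [if_neg (by omega), h]; push_cast; ring
  · have : ((k : ℕ) + j) % (n + 1) = k + j - (n + 1) := by
      rw [Nat.mod_eq_sub_mod (by omega), Nat.mod_eq_of_lt (by omega)]
    rw [this] at h
    rw [if_pos (by omega)]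
    have h2 : (r : ℕ) + (n + 2) = j + 1 + k := by omega
    have h3 := congrArg (fun t : ℕ => (t : ZMod (n + 2))) h2
    push_cast at h3 hN
    linear_combination h3 - hN

/-- The main identity on basis vectors. -/
lemma cyc_main (F : Type) [Field F] (m : ℕ) (heven : Even (m + 2)) (ε : F)
    (hε : ε = ((Equiv.Perm.sign (Fin.revPerm : Equiv.Perm (Fin (m + 2))) : ℤ) : F))
    (j : Fin (m + 3)) :
    ∑ σ : Equiv.Perm (Fin (m + 2)), (Equiv.Perm.sign σ : ℤ) •
      (List.ofFn fun k => cycX F (m + 3) ε ((j.succAbove (σ k) : Fin (m + 3)) : ℕ)).prod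
    = ((-1 : F) ^ (j : ℕ)) • cycX F (m + 3) ε (j : ℕ) := by
  have hN : ((m + 3 : ℕ) : ZMod (m + 3)) = 0 := ZMod.natCast_self _
  have hcinj : ∀ a b : Fin (m + 3), ((a : ℕ) : ZMod (m + 3)) = ((b : ℕ) : ZMod (m + 3)) → a = b := by
    intro a b h
    rw [ZMod.natCast_eq_natCast_iff'] at h
    rw [Nat.mod_eq_of_lt a.2, Nat.mod_eq_of_lt b.2] at h
    exact Fin.ext h
  set σf : Equiv.Perm (Fin (m + 2)) := (finRotate (m + 2)) ^ (j : ℕ) with hσf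
  set σb : Equiv.Perm (Fin (m + 2)) := σf * Fin.revPerm with hσb
  have hf : ∀ k, (((j.succAbove (σf k) : Fin (m + 3)) : ℕ) : ZMod (m + 3)) = (j : ℕ) + 1 + (k : ℕ) :=
    fun k => succAbove_rot (m + 1) j k
  have hb : ∀ k, (((j.succAbove (σb k) : Fin (m + 3)) : ℕ) : ZMod (m + 3)) = (j : ℕ) - 1 - (k : ℕ) := by
    intro k
    rw [hσb, Equiv.Perm.mul_apply, hf, Fin.revPerm_apply]
    have h1 : ((Fin.rev k : Fin (m + 2)) : ℕ) + k + 1 = m + 2 := by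
      rw [Fin.val_rev]; omega
    have h3 := congrArg (fun t : ℕ => (t : ZMod (m + 3))) h1
    push_cast at h3 hN
    linear_combination h3 + hN
  have h12 := cyc_facts (m + 3) (by omega)
  have hne : σf ≠ σb := by
    intro h
    have h1 := hf 0
    rw [h, hb 0] at h1
    apply h12.2
    simp only [Fin.val_zero, Nat.cast_zero] at h1
    linear_combination -h1
  have hsf : (Equiv.Perm.sign σf : ℤ) = (-1) ^ (j : ℕ) := by
    rw [hσf, map_pow, sign_finRotate]
    have : Odd (m + 1) := by
      rcases heven with ⟨r, hr⟩; exact ⟨r - 1, by omega⟩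
    have e : m + 2 - 1 = m + 1 := rfl
    rw [e, this.neg_one_pow]; simp
  have hε2 : ε * ε = 1 := by
    rw [hε]
    rcases Int.units_eq_one_or (Equiv.Perm.sign (Fin.revPerm : Equiv.Perm (Fin (m + 2)))) with h | h <;>
      rw [h] <;> simp
  rw [← Finset.sum_subset (Finset.subset_univ {σf, σb}), Finset.sum_pair hne]
  · simp only [hf, hb]
    rw [cyc_fwd F (m + 3) (by omega) ε, cyc_bwd F (m + 3) (by omega) ε, hσb, Equiv.Perm.sign_mul]
    have e1 : ((j : ℕ) : ZMod (m + 3)) + 1 + ((m + 2 : ℕ) : ZMod (m + 3)) = (j : ℕ) := by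
      push_cast at hN ⊢; linear_combination hN
    have e2 : ((j : ℕ) : ZMod (m + 3)) - 1 + 1 = (j : ℕ) := by ring
    have e3 : ((j : ℕ) : ZMod (m + 3)) - ((m + 2 : ℕ) : ZMod (m + 3)) = (j : ℕ) + 1 := by
      push_cast at hN ⊢; linear_combination -hN
    have e4 : ε ^ (m + 2) = 1 := by
      obtain ⟨r, hr⟩ := heven
      rw [hr, ← two_mul, pow_mul, pow_two, hε2, one_pow]
    rw [e1, e2, e3, e4, cycX, Units.val_mul, hsf, ← Int.cast_smul_eq_zsmul F,
      ← Int.cast_smul_eq_zsmul F]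
    push_cast
    rw [← hε, mul_smul, ← smul_add, Matrix.smul_single, smul_eq_mul, mul_one,
      add_comm (Matrix.single _ _ ε)]
  · intro σ _ hσ
    simp only [Finset.mem_insert, Finset.mem_singleton, not_or] at hσ
    by_contra hz
    have hz' : (List.ofFn fun k => cycX F (m + 3) ε ((j.succAbove (σ k) : Fin (m + 3)) : ℕ)).prod ≠ 0 :=
      fun h => hz (by rw [h, smul_zero])
    set w : Fin (m + 2) → ZMod (m + 3) := fun k => (((j.succAbove (σ k) : Fin (m + 3)) : ℕ) : ZMod (m + 3))
      with hw
    have hwi : Function.Injective w := fun a b h =>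
      σ.injective (Fin.succAbove_right_injective (hcinj _ _ h))
    have hwj : ∀ k, w k ≠ (j : ℕ) := fun k h => Fin.succAbove_ne _ _ (hcinj _ _ h)
    rcases word_mono (m + 3) (m + 2) (by omega) w hwi (by
      intro k hk
      by_contra hcon
      rw [not_or] at hcon
      refine hz' (prod_ofFn_zero _ _ k hk (cycX_mul_zero F _ ε _ _ ?_ hcon.1 hcon.2))
      intro h
      have := hwi h
      simp at this) with h | h
    · have hs := word_start (m + 3) (m + 2) rfl ((j : ℕ) - w ⟨0, by omega⟩) (by
        intro k hk
        apply hwj k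
        rw [h k, ← hk]; ring)
      apply hσ.1
      ext1 k
      refine Fin.succAbove_right_injective (p := j) (hcinj _ _ ?_)
      rw [hf]
      change w k = _
      rw [h k]
      linear_combination -hs
    · have hs := word_start (m + 3) (m + 2) rfl (w ⟨0, by omega⟩ - (j : ℕ)) (by
        intro k hk
        apply hwj k
        rw [h k, ← hk]; ring)
      apply hσ.2
      ext1 k
      refine Fin.succAbove_right_injective (p := j) (hcinj _ _ ?_)
      rw [hb]
      change w k = _
      rw [h k]
      linear_combination hs

/-- The bracket as an alternating map. -/
noncomputable def bracketAlt (F : Type) [Field F] (n : ℕ) :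
    (Fin (n + 1) → F) [⋀^Fin n]→ₗ[F] (Fin (n + 1) → F) :=
  ∑ i : Fin (n + 1), (LinearMap.toSpanSingleton F (Fin (n + 1) → F)
      (((-1 : F) ^ (n + (i : ℕ))) • (Pi.single i 1 : Fin (n + 1) → F))).compAlternatingMap
    ((Matrix.detRowAlternating (n := Fin n) (R := F)).compLinearMap (LinearMap.funLeft F F i.succAbove))

lemma AlternatingMap_sum_apply' {F M M' ι κ : Type} [Field F] [AddCommGroup M] [Module F M]
    [AddCommGroup M'] [Module F M'] (s : Finset κ) (f : κ → M [⋀^ι]→ₗ[F] M') (v : ι → M) :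
    (∑ i ∈ s, f i) v = ∑ i ∈ s, f i v := by
  classical
  induction s using Finset.induction_on with
  | empty => simp
  | insert a s ha ih => rw [Finset.sum_insert ha, Finset.sum_insert ha, AlternatingMap.add_apply, ih]

lemma bracketAlt_apply (F : Type) [Field F] (n : ℕ) (v : Fin n → (Fin (n + 1) → F)) :
    bracketAlt F n v = simpleBracket F n v := by
  simp only [bracketAlt, simpleBracket]
  rw [AlternatingMap_sum_apply']
  refine Finset.sum_congr rfl fun i _ => ?_
  simp only [LinearMap.compAlternatingMap_apply, LinearMap.toSpanSingleton_apply, smul_smul]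
  rw [mul_comm]
  rfl

lemma bracket_basis (F : Type) [Field F] (n : ℕ) (j : Fin (n + 1)) :
    simpleBracket F n (fun k => Pi.single (j.succAbove k) 1)
      = ((-1 : F) ^ (n + (j : ℕ))) • (Pi.single j 1 : Fin (n + 1) → F) := by
  rw [simpleBracket, Finset.sum_eq_single j]
  · have : (Matrix.of fun k l : Fin n =>
      (Pi.single (j.succAbove k) 1 : Fin (n + 1) → F) (j.succAbove l)) = 1 := by
      ext k l
      simp [Matrix.one_apply, Pi.single_apply, eq_comm]
    rw [this]; simp
  · intro i _ hi
    obtain ⟨k, hk⟩ := Fin.exists_succAbove_eq hi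
    rw [Matrix.det_eq_zero_of_row_eq_zero k, mul_zero, zero_smul]
    intro l
    simp only [Matrix.of_apply]
    rw [hk]
    simp [Pi.single_apply, Fin.succAbove_ne]
  · simp

lemma inj_factor (n : ℕ) (v : Fin n → Fin (n + 1)) (hv : Function.Injective v) :
    ∃ (j : Fin (n + 1)) (τ : Equiv.Perm (Fin n)), ∀ k, v k = j.succAbove (τ k) := by
  have hns : ¬ Function.Surjective v := by
    intro hs
    have := Fintype.card_le_of_surjective v hs
    simp at this
  simp only [Function.Surjective, not_forall, not_exists] at hns
  obtain ⟨j, hj⟩ := hns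
  choose t ht using fun k => Fin.exists_succAbove_eq (hj k)
  have hti : Function.Injective t := fun a b h => hv (by rw [← ht a, ← ht b, h])
  exact ⟨j, Equiv.ofBijective t (Finite.injective_iff_bijective.mp hti), fun k => (ht k).symm⟩

/-- For `n ≥ 4` even, the simple `n`-Lie algebra `L_{n+1}` embeds into the minus algebra
`A⁻` of some associative algebra `A`: there is an injective linear map `i : L_{n+1} → A`
turning the `n`-Lie bracket into the `n`-ary alternating sum. -/
theorem pozhidaev_even (F : Type) [Field F] (hF : ringChar F ≠ 2)
    (n : ℕ) (hn : 4 ≤ n) (heven : Even n) :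
    ∃ (A : Type) (_ : Ring A), letI := ‹Ring A›;
    ∃ _ : Algebra F A, letI := ‹Algebra F A›;
    ∃ i : (Fin (n + 1) → F) →ₗ[F] A,
      Function.Injective i ∧
      ∀ z : Fin n → (Fin (n + 1) → F),
        i (simpleBracket F n z) =
          ∑ σ : Equiv.Perm (Fin n),
            (Equiv.Perm.sign σ : ℤ) • (List.ofFn fun k => i (z (σ k))).prod := by
  obtain ⟨m, rfl⟩ : ∃ m, n = m + 2 := ⟨n - 2, by omega⟩
  let ε : F := ((Equiv.Perm.sign (Fin.revPerm : Equiv.Perm (Fin (m + 2))) : ℤ) : F)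
  let x : Fin (m + 3) → Matrix (ZMod (m + 3)) (ZMod (m + 3)) F :=
    fun l => cycX F (m + 3) ε (l : ℕ)
  let i : (Fin (m + 3) → F) →ₗ[F] Matrix (ZMod (m + 3)) (ZMod (m + 3)) F :=
    Fintype.linearCombination F x
  have hi1 : ∀ l, i (Pi.single l 1) = x l := by
    intro l
    simp [i, Fintype.linearCombination_apply_single]
  refine ⟨Matrix (ZMod (m + 3)) (ZMod (m + 3)) F, inferInstance, inferInstance, i, ?_, ?_⟩
  · rw [← LinearMap.ker_eq_bot, LinearMap.ker_eq_bot']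
    intro v hv
    funext l
    have h12 := cyc_facts (m + 3) (by omega)
    have h := congrFun (congrFun hv (((l : ℕ) : ZMod (m + 3)) + 1)) ((l : ℕ) : ZMod (m + 3))
    simp only [i, Fintype.linearCombination_apply, Matrix.sum_apply, Matrix.smul_apply] at h
    rw [Finset.sum_eq_single l] at h
    · have e : ¬ ((l : ℕ) : ZMod (m + 3)) = ((l : ℕ) : ZMod (m + 3)) + 1 := by simp [h12.1]
      simpa [x, cycX, Matrix.single_apply, e] using h
    · intro b _ hb
      have hbl : ¬ ((b : ℕ) : ZMod (m + 3)) = ((l : ℕ) : ZMod (m + 3)) := by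
        intro h
        rw [ZMod.natCast_eq_natCast_iff', Nat.mod_eq_of_lt b.2, Nat.mod_eq_of_lt l.2] at h
        exact hb (Fin.ext h)
      have e : ¬ (((b : ℕ) : ZMod (m + 3)) = ((l : ℕ) : ZMod (m + 3)) + 1 ∧
          ((b : ℕ) : ZMod (m + 3)) + 1 = ((l : ℕ) : ZMod (m + 3))) := by
        rintro ⟨h1, h2⟩
        apply h12.2
        linear_combination h2 - h1
      simp only [x, cycX, Matrix.add_apply, Matrix.single_apply, hbl, e, and_false, if_false,
        add_zero, smul_zero]
    · simp
  · intro z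
    let R : (Fin (m + 3) → F) [⋀^Fin (m + 2)]→ₗ[F] Matrix (ZMod (m + 3)) (ZMod (m + 3)) F :=
      MultilinearMap.alternatization
        ((MultilinearMap.mkPiAlgebraFin F (m + 2)
          (Matrix (ZMod (m + 3)) (ZMod (m + 3)) F)).compLinearMap fun _ => i)
    have hR : ∀ z, R z = ∑ σ : Equiv.Perm (Fin (m + 2)),
            (Equiv.Perm.sign σ : ℤ) • (List.ofFn fun k => i (z (σ k))).prod := by
      intro z
      simp only [R, MultilinearMap.alternatization_apply]
      refine Finset.sum_congr rfl fun σ _ => ?_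
      simp [MultilinearMap.domDomCongr_apply, Units.smul_def]
    have hL : i.compAlternatingMap (bracketAlt F (m + 2)) = R := by
      refine Module.Basis.ext_alternating (Pi.basisFun F (Fin (m + 3))) fun v hv => ?_
      obtain ⟨j, τ, hτ⟩ := inj_factor _ v hv
      have e : (fun k => (Pi.basisFun F (Fin (m + 3))) (v k)) =
          (fun k => (Pi.single (j.succAbove k) 1 : Fin (m + 3) → F)) ∘ τ := by
        funext k
        simp [hτ k]
      rw [e, AlternatingMap.map_perm, AlternatingMap.map_perm]
      congr 1
      rw [LinearMap.compAlternatingMap_apply, bracketAlt_apply, bracket_basis, hR, map_smul, hi1]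
      simp only [hi1]
      rw [pow_add, heven.neg_one_pow, one_mul]
      exact (cyc_main F m heven ε rfl j).symm
    rw [← hR, ← hL, LinearMap.compAlternatingMap_apply, bracketAlt_apply]
end

section
/- Let n ≥ 4 be even and F a field of characteristic ≠ 2. In the free associative algebra F⟨x_1,...,x_{n+1}⟩ modulo the ideal I generated by G_i = (-1)^{⌊n/2⌋}(alt(x_1,...,x̂_i,...,x_{n+1}) + (-1)^{n+i} x_i), 1 ≤ i ≤ n+1, the cosets of the words that do not contain any factor x_{i_1} x_{i_2} ⋯ x_{i_n} with i_1 > i_2 > ⋯ > i_n form a basis of the quotient U = F⟨X⟩/I. In particular, U is infinite-dimensional. -/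
open FreeAlgebra

/-- The `n`-ary alternating sum in an associative algebra. -/
noncomputable def altSum {A : Type} [Ring A] (n : ℕ) (x : Fin n → A) : A :=
  ∑ σ : Equiv.Perm (Fin n), (Equiv.Perm.sign σ : ℤ) • (List.ofFn fun k => x (σ k)).prod

/-- A word (in the letters `x_1 < ⋯ < x_{n+1}`) is good if it contains no factor
`x_{i_1} ⋯ x_{i_n}` of length `n` with strictly decreasing subscripts. -/
def goodWord (n : ℕ) (l : List (Fin (n + 1))) : Prop :=
  ¬ ∃ u v w : List (Fin (n + 1)),
      l = u ++ v ++ w ∧ v.length = n ∧ v.Chain' (· > ·)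

/-- The monomial of `F⟨x_1, ..., x_{n+1}⟩` corresponding to a word. -/
noncomputable def mono (F : Type) [Field F] (n : ℕ) (l : List (Fin (n + 1))) :
    FreeAlgebra F (Fin (n + 1)) :=
  (l.map (ι F)).prod

/-- The relation whose `RingQuot` is `U = F⟨X⟩/⟨G_1, ..., G_{n+1}⟩`. -/
def rel {F : Type} [Field F] {n : ℕ} (G : Fin (n + 1) → FreeAlgebra F (Fin (n + 1)))
    (a b : FreeAlgebra F (Fin (n + 1))) : Prop :=
  ∃ i, a = G i ∧ b = 0

namespace EnvBasis

/-- Numerical value of a word, in base `n+2` with digits `1, ..., n+1`; it realizes deglex. -/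
def val (n : ℕ) : List (Fin (n + 1)) → ℕ
  | [] => 0
  | a :: l => ((a : ℕ) + 1) * (n + 2) ^ l.length + val n l

theorem val_append (n : ℕ) (u v : List (Fin (n + 1))) :
    val n (u ++ v) = val n u * (n + 2) ^ v.length + val n v := by
  induction u with
  | nil => simp [val]
  | cons a u ih => simp only [List.cons_append, val, ih, List.length_append, pow_add]; ring

theorem val_lt (n : ℕ) (u : List (Fin (n + 1))) : val n u < (n + 2) ^ u.length := by
  induction u with
  | nil => simp [val]
  | cons a u ih =>
    simp only [val, List.length_cons, pow_succ]
    have := a.isLt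
    have h : ((a : ℕ) + 1) * (n + 2) ^ u.length ≤ (n + 1) * (n + 2) ^ u.length :=
      Nat.mul_le_mul_right _ (by omega)
    nlinarith

theorem val_mono {n : ℕ} {a b : List (Fin (n + 1))} (hl : a.length ≤ b.length)
    (h : val n a < val n b) (u v : List (Fin (n + 1))) :
    val n (u ++ a ++ v) < val n (u ++ b ++ v) := by
  simp only [val_append]
  have h1 : val n u * (n + 2) ^ a.length ≤ val n u * (n + 2) ^ b.length :=
    Nat.mul_le_mul_left _ (Nat.pow_le_pow_right (by omega) hl)
  have h2 : 0 < (n + 2) ^ v.length := by positivity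
  have h3 := Nat.mul_lt_mul_of_pos_right (Nat.add_lt_add_of_le_of_lt h1 h) h2
  omega

theorem val_perm {n : ℕ} : ∀ {l l' : List (Fin (n + 1))}, l.Pairwise (· > ·) → l'.Perm l →
    l' ≠ l → val n l' < val n l
  | [], l', _, hp, hne => absurd hp.eq_nil hne
  | a :: t, [], _, hp, _ => by simp at hp
  | a :: t, b :: t', hs, hp, hne => by
    have hlen : t'.length = t.length := by simpa using hp.length_eq
    by_cases hab : b = a
    · subst hab
      have := val_perm (List.pairwise_cons.1 hs).2 ((List.perm_cons b).1 hp)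
        (fun h => hne (by rw [h]))
      simp only [val, hlen]; omega
    · have hb : b ∈ t := by
        have : b ∈ a :: t := hp.subset (by simp)
        simpa [hab] using this
      have hlt : (b : ℕ) < a := (List.pairwise_cons.1 hs).1 b hb
      have h1 := val_lt n t'
      simp only [val, hlen] at *
      have : ((b : ℕ) + 1 + 1) * (n + 2) ^ t.length ≤ ((a : ℕ) + 1) * (n + 2) ^ t.length :=
        Nat.mul_le_mul_right _ (by omega)
      nlinarith

/-- The decreasing word omitting `i`. -/
def W {n : ℕ} (i : Fin (n + 1)) : List (Fin (n + 1)) := List.ofFn fun k => i.succAbove (Fin.rev k)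

/-- The full decreasing word. -/
def D (n : ℕ) : List (Fin (n + 1)) := List.ofFn fun k => Fin.rev k

theorem W_length {n : ℕ} (i : Fin (n + 1)) : (W i).length = n := by simp [W]

theorem W_sorted {n : ℕ} (i : Fin (n + 1)) : (W i).Pairwise (· > ·) := by
  rw [W, List.pairwise_ofFn]
  intro a b h
  exact Fin.strictMono_succAbove i (Fin.rev_lt_rev.2 h)

theorem D_sorted (n : ℕ) : (D n).Pairwise (· > ·) := by
  rw [D, List.pairwise_ofFn]
  intro a b h
  exact Fin.rev_lt_rev.2 h

theorem nodup_of {n : ℕ} {l : List (Fin (n + 1))} (h : l.Pairwise (· > ·)) : l.Nodup :=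
  h.imp (fun h => ne_of_gt h)

theorem mem_W {n : ℕ} (i j : Fin (n + 1)) : j ∈ W i ↔ j ≠ i := by
  rw [W, List.mem_ofFn]
  constructor
  · rintro ⟨k, rfl⟩; exact Fin.succAbove_ne _ _
  · intro h
    obtain ⟨k, hk⟩ := Fin.exists_succAbove_eq h
    exact ⟨k.rev, by simpa using hk⟩

theorem W_inj {n : ℕ} {i j : Fin (n + 1)} (h : W i = W j) : i = j := by
  by_contra hne
  exact (mem_W i i).1 (h ▸ (mem_W j i).2 hne) rfl

theorem cons_W_perm {n : ℕ} (i : Fin (n + 1)) : (i :: W i).Perm (D n) := by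
  rw [List.perm_ext_iff_of_nodup]
  · intro a
    have : a ∈ D n := by rw [D, List.mem_ofFn]; exact ⟨a.rev, by simp⟩
    simp only [this, iff_true, List.mem_cons, mem_W]
    exact em _
  · rw [List.nodup_cons]
    exact ⟨by simp [mem_W], nodup_of (W_sorted i)⟩
  · exact nodup_of (D_sorted n)

theorem W_append_perm {n : ℕ} (i : Fin (n + 1)) : (W i ++ [i]).Perm (D n) :=
  (List.perm_append_singleton i (W i)).trans (cons_W_perm i)

theorem eq_of_perm {n : ℕ} {l l' : List (Fin (n + 1))} (h : l.Perm l')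
    (h1 : l.Pairwise (· > ·)) (h2 : l'.Pairwise (· > ·)) : l = l' := by
  by_contra hne
  have a := val_perm h2 h hne
  have b := val_perm h1 h.symm (Ne.symm hne)
  omega

theorem D_eq_left (n : ℕ) : Fin.last n :: W (Fin.last n) = D n := by
  refine eq_of_perm (cons_W_perm _) ?_ (D_sorted n)
  rw [List.pairwise_cons]
  refine ⟨fun a ha => ?_, W_sorted _⟩
  exact lt_of_le_of_ne (Fin.le_last a) ((mem_W _ _).1 ha)

theorem D_eq_right (n : ℕ) : W (0 : Fin (n + 1)) ++ [0] = D n := by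
  refine eq_of_perm (W_append_perm _) ?_ (D_sorted n)
  rw [List.pairwise_append]
  refine ⟨W_sorted _, by simp, ?_⟩
  intro a ha b hb
  simp only [List.mem_singleton] at hb
  subst hb
  exact Fin.pos_iff_ne_zero.2 ((mem_W _ _).1 ha)

theorem exists_W {n : ℕ} {l : List (Fin (n + 1))} (h : l.Pairwise (· > ·)) (hl : l.length = n) :
    ∃ i, l = W i := by
  obtain ⟨i, hi⟩ : ∃ i, i ∉ l := by
    by_contra hcon
    push Not at hcon
    have h1 : l.toFinset = Finset.univ := by ext; simp [hcon]
    have h2 := List.toFinset_card_of_nodup (nodup_of h)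
    rw [h1, hl] at h2
    simp at h2
  refine ⟨i, eq_of_perm ?_ h (W_sorted i)⟩
  refine List.Subperm.perm_of_length_le ?_ (by rw [W_length, hl])
  refine List.subperm_of_subset (nodup_of h) ?_
  intro a ha
  rw [mem_W]
  rintro rfl
  exact hi ha

theorem W_get {n : ℕ} (i : Fin (n + 1)) (k : ℕ) (hk : k < n) :
    ((W i)[k]'(by rw [W_length]; exact hk) : ℕ) = if n - k ≤ i then n - k - 1 else n - k := by
  simp only [W, List.getElem_ofFn, Fin.succAbove, Fin.lt_def, Fin.val_castSucc, Fin.val_rev]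
  split_ifs <;> simp [Fin.val_rev] <;> omega

/-- The only proper overlap of two decreasing words of length `n`. -/
theorem overlap {n : ℕ} {i j : Fin (n + 1)} {p v v' : List (Fin (n + 1))}
    (h : W i ++ v = p ++ W j ++ v') (h0 : 0 < p.length) (h1 : p.length < n) :
    i = 0 ∧ j = Fin.last n ∧ p = [Fin.last n] ∧ v = 0 :: v' := by
  have key : ∀ k (hk : p.length + k < n), (W i)[p.length + k]'(by rw [W_length]; exact hk)
      = (W j)[k]'(by rw [W_length]; omega) := by
    intro k hk
    have e1 : (W i ++ v)[p.length + k]? = (p ++ W j ++ v')[p.length + k]? := by rw [h]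
    rw [List.getElem?_append_left (by rw [W_length]; exact hk), List.append_assoc,
      List.getElem?_append_right (by omega), 
      List.getElem?_append_left (by rw [W_length]; omega)] at e1
    rw [List.getElem?_eq_getElem (by rw [W_length]; omega),
      List.getElem?_eq_getElem (by rw [W_length]; omega)] at e1
    simpa using e1
  have kv : ∀ k (hk : p.length + k < n), (if n - (p.length + k) ≤ i then n - (p.length + k) - 1
      else n - (p.length + k)) = (if n - k ≤ j then n - k - 1 else n - k) := by
    intro k hk
    rw [← W_get i _ hk, ← W_get j k (by omega), key k hk]
  have hj := j.isLt
  have k0 := kv 0 (by omega)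
  have hp1 : p.length = 1 ∧ (j : ℕ) = n := by
    simp only [Nat.add_zero, Nat.sub_zero] at k0
    split_ifs at k0 <;> omega
  have kl := kv (n - 1 - p.length) (by omega)
  have hi : (i : ℕ) = 0 := by
    have e : n - (p.length + (n - 1 - p.length)) = 1 := by omega
    rw [e] at kl
    split_ifs at kl <;> omega
  have hi' : i = 0 := Fin.ext hi
  have hj' : j = Fin.last n := Fin.ext hp1.2
  subst hi' hj'
  obtain ⟨a, rfl⟩ := List.length_eq_one_iff.1 hp1.1
  have ha : a = Fin.last n := by
    have e1 : (W (0 : Fin (n+1)) ++ v)[0]? = ([a] ++ W (Fin.last n) ++ v')[0]? := by rw [h]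
    rw [List.getElem?_append_left (by rw [W_length]; omega),
      List.getElem?_eq_getElem (by rw [W_length]; omega)] at e1
    simp only [List.cons_append, List.nil_append, List.getElem?_cons_zero, Option.some.injEq] at e1
    have := W_get (0 : Fin (n+1)) 0 (by omega)
    rw [e1] at this
    apply Fin.ext
    rw [this]
    simp; omega
  subst ha
  refine ⟨rfl, rfl, rfl, ?_⟩
  have e : [Fin.last n] ++ W (Fin.last n) ++ v' = W 0 ++ (0 :: v') := by
    have := (D_eq_left n).trans (D_eq_right n).symm
    simp only [List.cons_append, List.nil_append]
    rw [← List.cons_append, this]; simp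
  rw [e] at h
  exact List.append_cancel_left h

section algebra
variable {F : Type} [Field F] {n : ℕ}

theorem mono_append (u v : List (Fin (n + 1))) : mono F n (u ++ v) = mono F n u * mono F n v := by
  simp [mono]

theorem basis_apply (l : List (Fin (n + 1))) :
    basisFreeMonoid F (Fin (n + 1)) (FreeMonoid.ofList l) = mono F n l := by
  simp [basisFreeMonoid, mono, equivMonoidAlgebraFreeMonoid, MonoidAlgebra.coeffLinearEquiv,
    FreeMonoid.lift_apply]

theorem mono_li : LinearIndependent F (mono F n) := by
  have := (basisFreeMonoid F (Fin (n + 1))).linearIndependent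
  have h := this.comp (FreeMonoid.ofList : List (Fin (n + 1)) → _) (Equiv.injective _)
  have e : mono F n = (basisFreeMonoid F (Fin (n + 1))) ∘
      (FreeMonoid.ofList : List (Fin (n + 1)) → _) := by
    funext l
    exact (basis_apply l).symm
  rw [e]
  exact h

theorem mono_span : Submodule.span F (Set.range (mono F n)) = ⊤ := by
  rw [← (basisFreeMonoid F (Fin (n + 1))).span_eq]
  congr 1
  ext x
  constructor
  · rintro ⟨l, rfl⟩; exact ⟨FreeMonoid.ofList l, basis_apply l⟩
  · rintro ⟨l, rfl⟩; exact ⟨FreeMonoid.toList l, (basis_apply (FreeMonoid.toList l)).symm⟩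

/-- Coefficient of a word. -/
noncomputable def coef (l : List (Fin (n + 1))) : FreeAlgebra F (Fin (n + 1)) →ₗ[F] F :=
  (basisFreeMonoid F (Fin (n + 1))).coord (FreeMonoid.ofList l)

theorem coef_mono (l l' : List (Fin (n + 1))) :
    coef (F := F) l (mono F n l') = if l' = l then 1 else 0 := by
  rw [coef, ← basis_apply, Module.Basis.coord_apply, Module.Basis.repr_self]
  split_ifs with h
  · rw [h, Finsupp.single_eq_same]
  · exact Finsupp.single_eq_of_ne (fun h' => h (FreeMonoid.ofList.injective h').symm)

/-- Span of the words below `w`. -/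
def T (F : Type) [Field F] {n : ℕ} (w : List (Fin (n + 1))) :
    Submodule F (FreeAlgebra F (Fin (n + 1))) :=
  Submodule.span F {x | ∃ l, l.length ≤ w.length ∧ val n l < val n w ∧ x = mono F n l}

/-- Span of the multiples of the generators with leading word of value below `m`. -/
def J (H : Fin (n + 1) → FreeAlgebra F (Fin (n + 1))) (m : ℕ) :
    Submodule F (FreeAlgebra F (Fin (n + 1))) :=
  Submodule.span F {x | ∃ p i q, val n (p ++ W i ++ q) < m ∧ x = mono F n p * H i * mono F n q}

variable {H : Fin (n + 1) → FreeAlgebra F (Fin (n + 1))}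

theorem J_mul {m m' : ℕ} (u v : List (Fin (n + 1)))
    (hm : ∀ a : List (Fin (n + 1)), a.length = n + 1 → val n a < m → val n (u ++ a ++ v) < m')
    {x : FreeAlgebra F (Fin (n + 1))}
    (hx : x ∈ Submodule.span F {x | ∃ p i q, (p ++ W i ++ q).length = n + 1 ∧
      val n (p ++ W i ++ q) < m ∧ x = mono F n p * H i * mono F n q}) :
    mono F n u * x * mono F n v ∈ J H m' := by
  induction hx using Submodule.span_induction with
  | mem x hx =>
    obtain ⟨p, i, q, hl, hv, rfl⟩ := hx
    refine Submodule.subset_span ⟨u ++ p, i, q ++ v, ?_, ?_⟩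
    · simpa [List.append_assoc] using hm _ hl hv
    · simp only [mono_append, mul_assoc]
  | zero => simp
  | add x y _ _ hx hy => rw [mul_add, add_mul]; exact add_mem hx hy
  | smul c x _ hx => rw [mul_smul_comm, smul_mul_assoc]; exact Submodule.smul_mem _ _ hx

theorem T_right {w : List (Fin (n + 1))} {t : FreeAlgebra F (Fin (n + 1))} (ht : t ∈ T F w)
    (i : Fin (n + 1)) (u m v : List (Fin (n + 1))) :
    mono F n u * H i * mono F n m * t * mono F n v ∈ J H (val n (u ++ W i ++ m ++ w ++ v)) := by
  rw [T] at ht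
  induction ht using Submodule.span_induction with
  | mem x hx =>
    obtain ⟨l, hl, hv, rfl⟩ := hx
    refine Submodule.subset_span ⟨u, i, m ++ l ++ v, ?_, ?_⟩
    · simpa [List.append_assoc] using val_mono hl hv (u ++ W i ++ m) v
    · simp only [mono_append, mul_assoc]
  | zero => simp
  | add x y _ _ hx hy => rw [mul_add, add_mul]; exact add_mem hx hy
  | smul c x _ hx => rw [mul_smul_comm, smul_mul_assoc]; exact Submodule.smul_mem _ _ hx

theorem T_left {w : List (Fin (n + 1))} {t : FreeAlgebra F (Fin (n + 1))} (ht : t ∈ T F w)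
    (i : Fin (n + 1)) (u m v : List (Fin (n + 1))) :
    mono F n u * t * mono F n m * H i * mono F n v ∈ J H (val n (u ++ w ++ m ++ W i ++ v)) := by
  rw [T] at ht
  induction ht using Submodule.span_induction with
  | mem x hx =>
    obtain ⟨l, hl, hv, rfl⟩ := hx
    refine Submodule.subset_span ⟨u ++ l ++ m, i, v, ?_, ?_⟩
    · simpa [List.append_assoc] using val_mono hl hv u (m ++ W i ++ v)
    · simp only [mono_append, mul_assoc]
  | zero => simp
  | add x y _ _ hx hy => rw [mul_add, add_mul, add_mul, add_mul]; exact add_mem hx hy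
  | smul c x _ hx =>
    rw [mul_smul_comm, smul_mul_assoc, smul_mul_assoc, smul_mul_assoc]
    exact Submodule.smul_mem _ _ hx

theorem T_both {w : List (Fin (n + 1))} {t : FreeAlgebra F (Fin (n + 1))} (ht : t ∈ T F w)
    (u v : List (Fin (n + 1))) :
    mono F n u * t * mono F n v ∈ T F (u ++ w ++ v) := by
  rw [T] at ht
  induction ht using Submodule.span_induction with
  | mem x hx =>
    obtain ⟨l, hl, hv, rfl⟩ := hx
    refine Submodule.subset_span ⟨u ++ l ++ v, ?_, val_mono hl hv u v, ?_⟩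
    · simp; omega
    · simp only [mono_append]
  | zero => simp
  | add x y _ _ hx hy => rw [mul_add, add_mul]; exact add_mem hx hy
  | smul c x _ hx => rw [mul_smul_comm, smul_mul_assoc]; exact Submodule.smul_mem _ _ hx

/-- The two facts about the (monic) generators which make the rewriting system confluent. -/
structure Good (H : Fin (n + 1) → FreeAlgebra F (Fin (n + 1))) : Prop where
  tail : ∀ i, H i - mono F n (W i) ∈ T F (W i)
  syz : mono F n [Fin.last n] * H (Fin.last n) - H 0 * mono F n [0] ∈
    Submodule.span F {x | ∃ p i q, (p ++ W i ++ q).length = n + 1 ∧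
      val n (p ++ W i ++ q) < val n (D n) ∧ x = mono F n p * H i * mono F n q}

theorem confluent (hH : Good H) {i j : Fin (n + 1)} {u v u' v' : List (Fin (n + 1))}
    (h : u ++ W i ++ v = u' ++ W j ++ v') (hle : u.length ≤ u'.length) :
    mono F n u * H i * mono F n v - mono F n u' * H j * mono F n v' ∈
      J H (val n (u ++ W i ++ v)) := by
  have h' : u ++ (W i ++ v) = u' ++ (W j ++ v') := by simpa [List.append_assoc] using h
  obtain ⟨p, rfl⟩ : ∃ p, u' = u ++ p := by
    have := List.prefix_of_prefix_length_le (List.prefix_append u (W i ++ v))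
      (h' ▸ List.prefix_append u' (W j ++ v')) hle
    obtain ⟨p, hp⟩ := this
    exact ⟨p, hp.symm⟩
  have h2 : W i ++ v = p ++ W j ++ v' := by
    rw [List.append_assoc u p] at h'
    simpa [List.append_assoc] using List.append_cancel_left h'
  rcases Nat.eq_zero_or_pos p.length with h0 | h0
  · have : p = [] := List.length_eq_zero_iff.1 h0
    subst this
    simp only [List.nil_append] at h2
    obtain ⟨e1, rfl⟩ := List.append_inj h2 (by rw [W_length, W_length])
    obtain rfl := W_inj e1
    simp
  · rcases Nat.lt_or_ge p.length n with h1 | h1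
    · obtain ⟨rfl, rfl, rfl, rfl⟩ := overlap h2 h0 h1
      have := J_mul (H := H) (m := val n (D n)) (m' := val n (u ++ D n ++ v')) u v'
        (fun a ha hv => val_mono (by simp [ha, D]) hv u v') hH.syz
      have e : u ++ W 0 ++ 0 :: v' = u ++ D n ++ v' := by
        rw [← D_eq_right]; simp
      rw [e]
      have := neg_mem this
      convert this using 1
      rw [show (0 :: v' : List (Fin (n + 1))) = [0] ++ v' from rfl]
      simp only [mono_append]
      noncomm_ring
    · obtain ⟨m, rfl⟩ : ∃ m, p = W i ++ m := by
        have := List.prefix_of_prefix_length_le (List.prefix_append (W i) v)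
          (by rw [h2, List.append_assoc]; exact List.prefix_append p _ : p <+: W i ++ v)
          (by rw [W_length]; exact h1)
        obtain ⟨m, hm⟩ := this
        exact ⟨m, hm.symm⟩
      have h3 : v = m ++ W j ++ v' := by
        simp only [List.append_assoc] at h2
        simpa [List.append_assoc] using List.append_cancel_left h2
      subst h3
      have a := T_right (H := H) (hH.tail j) i u m v'
      have b := T_left (H := H) (hH.tail i) j u m v'
      have e : u ++ W i ++ (m ++ W j ++ v') = u ++ W i ++ m ++ W j ++ v' := by
        simp [List.append_assoc]
      rw [e]
      have := sub_mem b a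
      convert this using 1
      simp only [mono_append]
      noncomm_ring

theorem confluent' (hH : Good H) {i j : Fin (n + 1)} {u v u' v' : List (Fin (n + 1))}
    (h : u ++ W i ++ v = u' ++ W j ++ v') :
    mono F n u * H i * mono F n v - mono F n u' * H j * mono F n v' ∈
      J H (val n (u ++ W i ++ v)) := by
  rcases le_total u.length u'.length with hle | hle
  · exact confluent hH h hle
  · have := neg_mem (confluent hH h.symm hle)
    rw [h]
    simpa using this

theorem not_good_iff (l : List (Fin (n + 1))) :
    ¬ goodWord n l ↔ ∃ u i v, l = u ++ W i ++ v := by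
  rw [goodWord, not_not]
  constructor
  · rintro ⟨u, v, w, rfl, hl, hc⟩
    obtain ⟨i, rfl⟩ := exists_W (List.isChain_iff_pairwise.1 hc) hl
    exact ⟨u, i, w, rfl⟩
  · rintro ⟨u, i, v, rfl⟩
    exact ⟨u, W i, v, rfl, W_length i, List.isChain_iff_pairwise.2 (W_sorted i)⟩

/-- Chosen reducer of a bad word. -/
theorem exists_g (hH : Good H) : ∃ g : {l : List (Fin (n + 1)) // ¬ goodWord n l} →
    FreeAlgebra F (Fin (n + 1)),
    (∀ l, g l - mono F n l.1 ∈ T F l.1) ∧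
    ∀ m, J H m ≤ Submodule.span F (Set.range g) := by
  choose u i v huv using fun l : {l : List (Fin (n + 1)) // ¬ goodWord n l} =>
    (not_good_iff l.1).1 l.2
  refine ⟨fun l => mono F n (u l) * H (i l) * mono F n (v l), ?_, ?_⟩
  · intro l
    have := T_both (hH.tail (i l)) (u l) (v l)
    rw [← huv l] at this
    convert this using 1
    conv_lhs => rw [huv l]
    simp only [mono_append]
    noncomm_ring
  · intro m
    induction m using Nat.strong_induction_on with
    | _ m ih =>
      rw [J, Submodule.span_le]
      rintro _ ⟨p, k, q, hv, rfl⟩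
      have hb : ¬ goodWord n (p ++ W k ++ q) := (not_good_iff _).2 ⟨p, k, q, rfl⟩
      have h1 := ih _ hv (confluent' hH (huv ⟨_, hb⟩))
      have h2 : mono F n (u ⟨_, hb⟩) * H (i ⟨_, hb⟩) * mono F n (v ⟨_, hb⟩) ∈
        Submodule.span F (Set.range fun l => mono F n (u l) * H (i l) * mono F n (v l)) :=
        Submodule.subset_span ⟨⟨_, hb⟩, rfl⟩
      simpa using add_mem h1 h2

theorem coef_T {l w : List (Fin (n + 1))} (h : val n w ≤ val n l)
    {t : FreeAlgebra F (Fin (n + 1))} (ht : t ∈ T F w) : coef l t = 0 := by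
  have : T F w ≤ LinearMap.ker (coef (F := F) l) := by
    rw [T, Submodule.span_le]
    rintro _ ⟨a, _, hv, rfl⟩
    rw [SetLike.mem_coe, LinearMap.mem_ker, coef_mono, if_neg]
    rintro rfl
    omega
  exact this ht

theorem disjoint (hH : Good H) {f : FreeAlgebra F (Fin (n + 1))}
    (h1 : f ∈ Submodule.span F (Set.range fun l : {l : List (Fin (n + 1)) // goodWord n l} =>
      mono F n l.1))
    (h2 : f ∈ ⨆ m, J H m) : f = 0 := by
  obtain ⟨g, hg, hJ⟩ := exists_g hH
  have h3 := (iSup_le hJ) h2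
  obtain ⟨c, rfl⟩ := (Finsupp.mem_span_range_iff_exists_finsupp).1 h3
  by_cases hc : c = 0
  · simp [hc]
  exfalso
  obtain ⟨l, hl, hmax⟩ := Finset.exists_max_image c.support (fun l => val n l.1)
    (Finsupp.support_nonempty_iff.2 hc)
  have hz : ∀ f ∈ Submodule.span F (Set.range fun l : {l : List (Fin (n + 1)) // goodWord n l} =>
      mono F n l.1), coef l.1 f = 0 := by
    intro f hf
    have : Submodule.span F (Set.range fun l : {l : List (Fin (n + 1)) // goodWord n l} =>
      mono F n l.1) ≤ LinearMap.ker (coef (F := F) l.1) := by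
      rw [Submodule.span_le]
      rintro _ ⟨a, rfl⟩
      rw [SetLike.mem_coe, LinearMap.mem_ker, coef_mono, if_neg]
      intro h
      exact l.2 (h ▸ a.2)
    exact this hf
  have h4 := hz _ h1
  rw [Finsupp.sum, map_sum, Finset.sum_eq_single l] at h4
  · have h5 : g l = mono F n l.1 + (g l - mono F n l.1) := by abel
    rw [map_smul, h5, map_add, coef_mono, if_pos rfl, coef_T le_rfl (hg l)] at h4
    simp at h4
    simp [h4] at hl
  · intro b hb hne
    have h5 : g b = mono F n b.1 + (g b - mono F n b.1) := by abel
    rw [map_smul, h5, map_add, coef_mono, if_neg (fun h => hne (Subtype.ext h)),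
      coef_T (hmax b hb) (hg b)]
    simp
  · intro h; exact absurd hl h

theorem spanning (hH : Good H) (l : List (Fin (n + 1))) :
    mono F n l ∈ Submodule.span F (Set.range fun l : {l : List (Fin (n + 1)) // goodWord n l} =>
      mono F n l.1) ⊔ ⨆ m, J H m := by
  induction hm : val n l using Nat.strong_induction_on generalizing l with
  | _ m ih =>
    by_cases hl : goodWord n l
    · exact Submodule.mem_sup_left (Submodule.subset_span ⟨⟨l, hl⟩, rfl⟩)
    · obtain ⟨u, i, v, rfl⟩ := (not_good_iff l).1 hl
      have h1 := T_both (hH.tail i) u v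
      have h2 : T F (u ++ W i ++ v) ≤ Submodule.span F (Set.range
          fun l : {l : List (Fin (n + 1)) // goodWord n l} => mono F n l.1) ⊔ ⨆ m, J H m := by
        rw [T, Submodule.span_le]
        rintro _ ⟨a, _, hv, rfl⟩
        exact ih _ (hm ▸ hv) a rfl
      have h3 : mono F n u * H i * mono F n v ∈ ⨆ m, J H m :=
        Submodule.mem_iSup_of_mem (val n (u ++ W i ++ v) + 1)
          (Submodule.subset_span ⟨u, i, v, by omega, rfl⟩)
      have := sub_mem (Submodule.mem_sup_right h3) (h2 h1)
      convert this using 1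
      simp only [mono_append]
      noncomm_ring

theorem mul_mem_J (u v : List (Fin (n + 1))) {x : FreeAlgebra F (Fin (n + 1))}
    (hx : x ∈ ⨆ m, J H m) : mono F n u * x * mono F n v ∈ ⨆ m, J H m := by
  have : (⨆ m, J H m) ≤ (⨆ m, J H m).comap
      ((LinearMap.mulRight F (mono F n v)).comp (LinearMap.mulLeft F (mono F n u))) := by
    refine iSup_le fun m => ?_
    rw [J, Submodule.span_le]
    rintro _ ⟨p, i, q, hv, rfl⟩
    refine Submodule.mem_iSup_of_mem (val n (u ++ p ++ W i ++ (q ++ v)) + 1)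
      (Submodule.subset_span ⟨u ++ p, i, q ++ v, by omega, ?_⟩)
    simp only [mono_append, LinearMap.comp_apply, LinearMap.mulLeft_apply,
      LinearMap.mulRight_apply, mul_assoc]
  exact this hx

theorem left_mem_J (a : FreeAlgebra F (Fin (n + 1))) {x : FreeAlgebra F (Fin (n + 1))}
    (hx : x ∈ ⨆ m, J H m) : a * x ∈ ⨆ m, J H m := by
  have ha : a ∈ Submodule.span F (Set.range (mono F n)) := by rw [mono_span]; trivial
  induction ha using Submodule.span_induction with
  | mem y hy =>
    obtain ⟨l, rfl⟩ := hy
    simpa [mono] using mul_mem_J l [] hx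
  | zero => simp
  | add y z _ _ hy hz => rw [add_mul]; exact add_mem hy hz
  | smul c y _ hy => rw [smul_mul_assoc]; exact Submodule.smul_mem _ _ hy

theorem right_mem_J (a : FreeAlgebra F (Fin (n + 1))) {x : FreeAlgebra F (Fin (n + 1))}
    (hx : x ∈ ⨆ m, J H m) : x * a ∈ ⨆ m, J H m := by
  have ha : a ∈ Submodule.span F (Set.range (mono F n)) := by rw [mono_span]; trivial
  induction ha using Submodule.span_induction with
  | mem y hy =>
    obtain ⟨l, rfl⟩ := hy
    simpa [mono] using mul_mem_J [] l hx
  | zero => simp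
  | add y z _ _ hy hz => rw [mul_add]; exact add_mem hy hz
  | smul c y _ hy => rw [mul_smul_comm]; exact Submodule.smul_mem _ _ hy

theorem H_mem_J (i : Fin (n + 1)) : H i ∈ ⨆ m, J H m :=
  Submodule.mem_iSup_of_mem (val n ([] ++ W i ++ []) + 1)
    (Submodule.subset_span ⟨[], i, [], by omega, by simp [mono]⟩)

variable {G : Fin (n + 1) → FreeAlgebra F (Fin (n + 1))}

theorem ker_le (hGH : ∀ i, G i ∈ ⨆ m, J H m) {x : FreeAlgebra F (Fin (n + 1))}
    (hx : RingQuot.mkAlgHom F (rel G) x = 0) : x ∈ ⨆ m, J H m := by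
  have key : ∀ a b, RingQuot.Rel (rel G) a b → a - b ∈ ⨆ m, J H m := by
    intro a b h
    induction h with
    | of h => obtain ⟨i, rfl, rfl⟩ := h; simpa using hGH i
    | add_left _ ih => simpa using ih
    | mul_left _ ih => rw [← sub_mul]; exact right_mem_J _ ih
    | mul_right _ ih => rw [← mul_sub]; exact left_mem_J _ ih
  have h0 : RingQuot.mkAlgHom F (rel G) x = RingQuot.mkAlgHom F (rel G) 0 := by rw [hx, map_zero]
  have h1 : Quot.mk (RingQuot.Rel (rel G)) x = Quot.mk (RingQuot.Rel (rel G)) 0 := by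
    simpa [RingQuot.mkAlgHom_def, RingQuot.mkRingHom_def] using h0
  have h2 := Quot.eqvGen_exact h1
  have : ∀ a b, Relation.EqvGen (RingQuot.Rel (rel G)) a b → a - b ∈ ⨆ m, J H m := by
    intro a b h
    induction h with
    | rel a b h => exact key a b h
    | refl a => simp
    | symm a b _ ih => simpa using neg_mem ih
    | trans a b c _ _ h1 h2 => simpa using add_mem h1 h2
  simpa using this _ _ h2

theorem J_le_ker (hGH : ∀ i, RingQuot.mkAlgHom F (rel G) (H i) = 0)
    {x : FreeAlgebra F (Fin (n + 1))} (hx : x ∈ ⨆ m, J H m) :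
    RingQuot.mkAlgHom F (rel G) x = 0 := by
  have : (⨆ m, J H m) ≤ LinearMap.ker (RingQuot.mkAlgHom F (rel G)).toLinearMap := by
    refine iSup_le fun m => ?_
    rw [J, Submodule.span_le]
    rintro _ ⟨p, i, q, hv, rfl⟩
    simp [hGH]
  exact this hx

theorem assembled (hH : Good H) (hn : 2 ≤ n) (h1 : ∀ i, G i ∈ ⨆ m, J H m)
    (h2 : ∀ i, RingQuot.mkAlgHom F (rel G) (H i) = 0) :
    LinearIndependent F
      (fun l : {l : List (Fin (n + 1)) // goodWord n l} =>
        RingQuot.mkAlgHom F (rel G) (mono F n l.1)) ∧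
    Submodule.span F
      (Set.range fun l : {l : List (Fin (n + 1)) // goodWord n l} =>
        RingQuot.mkAlgHom F (rel G) (mono F n l.1)) = ⊤ ∧
    ¬ Module.Finite F (RingQuot (rel G)) := by
  have hli : LinearIndependent F
      (fun l : {l : List (Fin (n + 1)) // goodWord n l} =>
        RingQuot.mkAlgHom F (rel G) (mono F n l.1)) := by
    have hmi : LinearIndependent F
        (fun l : {l : List (Fin (n + 1)) // goodWord n l} => mono F n l.1) :=
      mono_li.comp _ Subtype.val_injective

    refine LinearIndependent.map hmi (f := (RingQuot.mkAlgHom F (rel G)).toLinearMap) ?_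
    rw [Submodule.disjoint_def]
    intro x hx hk
    exact disjoint hH hx (ker_le h1 (by simpa using hk))
  refine ⟨hli, ?_, ?_⟩
  · rw [eq_top_iff]
    rintro y -
    obtain ⟨x, rfl⟩ := RingQuot.mkAlgHom_surjective F (rel G) y
    have hx : x ∈ Submodule.span F (Set.range (mono F n)) := by rw [mono_span]; trivial
    have hle : Submodule.span F (Set.range (mono F n)) ≤ (Submodule.span F
      (Set.range fun l : {l : List (Fin (n + 1)) // goodWord n l} =>
        RingQuot.mkAlgHom F (rel G) (mono F n l.1))).comap
        (RingQuot.mkAlgHom F (rel G)).toLinearMap := by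
      rw [Submodule.span_le]
      rintro _ ⟨l, rfl⟩
      refine (sup_le ?_ ?_ : _ ≤ (Submodule.span F
        (Set.range fun l : {l : List (Fin (n + 1)) // goodWord n l} =>
        RingQuot.mkAlgHom F (rel G) (mono F n l.1))).comap
        (RingQuot.mkAlgHom F (rel G)).toLinearMap) (spanning hH l)
      · rw [Submodule.span_le]
        rintro _ ⟨a, rfl⟩
        exact Submodule.subset_span ⟨a, rfl⟩
      · intro z hz
        have := J_le_ker h2 hz
        simp [this]
    exact hle hx
  · intro hfin
    have hf : Finite {l : List (Fin (n + 1)) // goodWord n l} := hli.finite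
    have hgood : ∀ k, goodWord n (List.replicate k 0) := by
      rintro k ⟨u, v, w, h, hl, hc⟩
      have hv : ∀ a ∈ v, a = 0 := by
        intro a ha
        have : a ∈ List.replicate k (0 : Fin (n + 1)) := by rw [h]; simp [ha]
        exact List.eq_of_mem_replicate this
      match v, hl, hc with
      | [], hl, _ => simp at hl; omega
      | [a], hl, _ => simp at hl; omega
      | a :: b :: t, _, hc =>
        have e := hv a (by simp)
        have e' := hv b (by simp)
        have := (List.isChain_cons_cons.1 hc).1
        subst e e'
        simp at this
    refine not_injective_infinite_finite
      (fun k : ℕ => (⟨List.replicate k 0, hgood k⟩ : {l : List (Fin (n + 1)) // goodWord n l})) ?_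
    intro a b h
    simpa using congrArg (fun l => l.1.length) h

end algebra

section signs

theorem sum_perm_succ {A : Type} [AddCommGroup A] (n : ℕ)
    (f : Fin (n + 1) → (Fin n → Fin (n + 1)) → A) :
    ∑ i : Fin (n + 1), ((-1 : ℤ) ^ (i : ℕ)) • ∑ τ : Equiv.Perm (Fin n),
      (Equiv.Perm.sign τ : ℤ) • f i (fun k => i.succAbove (τ k)) =
    ∑ σ : Equiv.Perm (Fin (n + 1)), (Equiv.Perm.sign σ : ℤ) • f (σ 0) (fun k => σ k.succ) := by
  simp only [Finset.smul_sum]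
  rw [← Finset.sum_product', Finset.univ_product_univ]
  let φ : Fin (n + 1) × Equiv.Perm (Fin n) → Equiv.Perm (Fin (n + 1)) := fun x =>
    x.1.cycleRange.symm * Equiv.Perm.decomposeFin.symm (0, x.2)
  have h0 : ∀ x, φ x 0 = x.1 := by
    intro x
    simp [φ, Fin.cycleRange_symm_zero]
  have hs : ∀ x k, φ x (Fin.succ k) = x.1.succAbove (x.2 k) := by
    intro x k
    simp [φ, Fin.cycleRange_symm_succ]
  have hinj : Function.Injective φ := by
    rintro ⟨i, τ⟩ ⟨j, ρ⟩ h
    have e1 : i = j := (h0 (i, τ)).symm.trans ((congrArg (fun s => s 0) h).trans (h0 (j, ρ)))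
    subst e1
    have : τ = ρ := by
      ext k
      have := hs (i, τ) k
      rw [h, hs] at this
      exact congrArg Fin.val (Fin.succAbove_right_injective this).symm
    rw [this]
  have hbij : Function.Bijective φ := by
    rw [Fintype.bijective_iff_injective_and_card]
    refine ⟨hinj, ?_⟩
    simp [Fintype.card_perm, Nat.factorial_succ]
  refine Fintype.sum_bijective φ hbij _ _ ?_
  rintro x
  have hsg : (Equiv.Perm.sign (φ x) : ℤ) = (-1) ^ (x.1 : ℕ) * (Equiv.Perm.sign x.2 : ℤ) := by
    simp [φ, Equiv.Perm.sign_symm, Fin.sign_cycleRange, Equiv.Perm.decomposeFin.symm_sign]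
  rw [hsg, h0, mul_smul]
  simp only [hs]

theorem alt_syz {A : Type} [Ring A] (n : ℕ) (hn : Even n) (x : Fin (n + 1) → A) :
    ∑ i : Fin (n + 1), ((-1 : ℤ) ^ (i : ℕ)) • (x i * altSum n (fun k => x (i.succAbove k))) =
    ∑ i : Fin (n + 1), ((-1 : ℤ) ^ (i : ℕ)) • (altSum n (fun k => x (i.succAbove k)) * x i) := by
  have h1 := sum_perm_succ n (fun i s => x i * (List.ofFn fun k => x (s k)).prod)
  have h2 := sum_perm_succ n (fun i s => (List.ofFn fun k => x (s k)).prod * x i)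
  simp only [altSum, Finset.mul_sum, Finset.sum_mul, mul_smul_comm, smul_mul_assoc]
  rw [h1, h2]
  refine (Fintype.sum_equiv (Equiv.mulRight (finRotate (n + 1))) _ _ ?_).symm
  intro σ
  have hsg : Equiv.Perm.sign (σ * finRotate (n + 1)) = Equiv.Perm.sign σ := by
    simp [sign_finRotate, hn.neg_one_pow]
  rw [Equiv.coe_mulRight, hsg]
  congr 1
  rw [← List.prod_cons, ← List.ofFn_succ (f := fun k => x ((σ * finRotate (n + 1)) k)),
    List.ofFn_succ', List.concat_eq_append, List.prod_append]
  simp [Equiv.Perm.mul_apply]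

variable {F : Type} [Field F] {n : ℕ}

theorem altSum_mono (i : Fin (n + 1)) :
    altSum n (fun k => ι F (i.succAbove k)) = ∑ σ : Equiv.Perm (Fin n),
      (Equiv.Perm.sign σ : ℤ) • mono F n (List.ofFn fun k => i.succAbove (σ k)) := by
  simp only [altSum, mono, List.map_ofFn, Function.comp_def]

theorem tail_alt (i : Fin (n + 1)) :
    altSum n (fun k => ι F (i.succAbove k)) -
      (Equiv.Perm.sign (Fin.revPerm : Equiv.Perm (Fin n)) : ℤ) • mono F n (W i) ∈ T F (W i) := by
  rw [altSum_mono, ← Finset.add_sum_erase _ _ (Finset.mem_univ Fin.revPerm)]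
  have : (List.ofFn fun k => i.succAbove (Fin.revPerm k)) = W i := rfl
  rw [this, add_sub_cancel_left]
  refine sum_mem fun σ hσ => ?_
  refine zsmul_mem ?_ _
  refine Submodule.subset_span ⟨_, ?_, ?_, rfl⟩
  · simp [W_length]
  · refine val_perm (W_sorted i) ?_ ?_
    · have h1 := Equiv.Perm.ofFn_comp_perm σ i.succAbove
      have h2 := Equiv.Perm.ofFn_comp_perm Fin.revPerm i.succAbove
      exact h1.trans h2.symm
    · intro h
      apply (Finset.mem_erase.1 hσ).1
      rw [W, List.ofFn_inj] at h
      ext k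
      have := congrFun h k
      simpa using congrArg Fin.val (Fin.succAbove_right_injective this)

theorem single_T (hn : 2 ≤ n) (i : Fin (n + 1)) : ι F i ∈ T F (W i) := by
  refine Submodule.subset_span ⟨[i], ?_, ?_, by simp [mono]⟩
  · rw [W_length]; simp; omega
  · have hl := W_length i
    match h : W i, hl with
    | [], hl => simp at hl; omega
    | [a], hl => simp at hl; omega
    | a :: b :: t, _ =>
      have := i.isLt
      simp only [val, List.length_cons, List.length_nil, pow_zero, pow_succ]
      have hp : 0 < (n + 2) ^ t.length := by positivity
      have h1 : n + 2 ≤ (n + 2) ^ t.length * (n + 2) := Nat.le_mul_of_pos_left _ hp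
      have h2 : (n + 2) ^ t.length * (n + 2) ≤ ((a : ℕ) + 1) * ((n + 2) ^ t.length * (n + 2)) :=
        Nat.le_mul_of_pos_left _ (by omega)
      omega

end signs

theorem good_of (F : Type) [Field F] (n : ℕ) (hn : 4 ≤ n) (heven : Even n)
    (e : F) (he : e * ((Equiv.Perm.sign (Fin.revPerm : Equiv.Perm (Fin n)) : ℤ) : F) = 1)
    (H : Fin (n + 1) → FreeAlgebra F (Fin (n + 1)))
    (hH : ∀ i, H i = e • (altSum n (fun k => ι F (i.succAbove k)) +
      (-1 : F) ^ (n + (i : ℕ) + 1) • ι F i)) : Good H where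
  tail i := by
    have h1 := Submodule.smul_mem _ e (tail_alt (F := F) i)
    have h2 := Submodule.smul_mem _ e (Submodule.smul_mem _ ((-1 : F) ^ (n + (i : ℕ) + 1))
      (single_T (F := F) (by omega : 2 ≤ n) i))
    have := add_mem h1 h2
    convert this using 1
    rw [hH, smul_sub, ← Int.cast_smul_eq_zsmul F, smul_smul, he, one_smul, smul_add]
    abel
  syz := by
    have hs : ∑ i : Fin (n + 1), ((-1 : ℤ) ^ (i : ℕ)) • (ι F i * H i) =
        ∑ i : Fin (n + 1), ((-1 : ℤ) ^ (i : ℕ)) • (H i * ι F i) := by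
      have := congrArg (fun z => e • z) (alt_syz n heven (ι F : Fin (n + 1) → _))
      simp only [Finset.smul_sum] at this
      rw [← sub_eq_zero, ← Finset.sum_sub_distrib] at this ⊢
      rw [← this]
      refine Finset.sum_congr rfl fun i _ => ?_
      rw [hH]
      simp only [mul_smul_comm, smul_mul_assoc, mul_add, add_mul, smul_add,
        smul_comm e ((-1 : ℤ) ^ (i : ℕ))]
      abel
    rw [← Finset.add_sum_erase _ _ (Finset.mem_univ (Fin.last n)),
      ← Finset.add_sum_erase _ (fun i : Fin (n + 1) => ((-1 : ℤ) ^ (i : ℕ)) • (H i * ι F i))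
        (Finset.mem_univ 0)] at hs
    simp only [Fin.val_last, heven.neg_one_pow, one_smul, Fin.val_zero, pow_zero] at hs
    have hm : ∀ i : Fin (n + 1), mono F n [i] = ι F i := by intro i; simp [mono]
    have e2 : mono F n [Fin.last n] * H (Fin.last n) - H 0 * mono F n [0] =
        ∑ i ∈ Finset.univ.erase (0 : Fin (n + 1)), ((-1 : ℤ) ^ (i : ℕ)) • (H i * ι F i) -
        ∑ i ∈ Finset.univ.erase (Fin.last n), ((-1 : ℤ) ^ (i : ℕ)) • (ι F i * H i) := by
      rw [hm, hm, sub_eq_sub_iff_add_eq_add, hs]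
      abel
    rw [e2]
    refine sub_mem (sum_mem fun i hi => zsmul_mem (Submodule.subset_span ?_) _)
      (sum_mem fun i hi => zsmul_mem (Submodule.subset_span ?_) _)
    · refine ⟨[], i, [i], by simp [W_length], ?_, by simp [mono]⟩
      refine val_perm (D_sorted n) (W_append_perm i) ?_
      intro h
      rw [List.nil_append, ← D_eq_right] at h
      have := (List.append_inj' h rfl).2
      simp at this
      simp [this] at hi
    · refine ⟨[i], i, [], by simp [W_length], ?_, by simp [mono]⟩
      have hp := cons_W_perm i
      rw [show [i] ++ W i ++ [] = i :: W i by simp]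
      refine val_perm (D_sorted n) hp ?_
      intro h
      rw [← D_eq_left] at h
      have := (List.cons.inj h).1
      simp [this] at hi

end EnvBasis

/-- For `n ≥ 4` even, the cosets of the words containing no strictly decreasing factor of
length `n` form a basis of `U = F⟨X⟩/⟨G_1, ..., G_{n+1}⟩`, the universal associative
envelope of the simple `n`-Lie algebra `L_{n+1}`; in particular `U` is
infinite-dimensional. -/
theorem monomial_basis_of_envelope (F : Type) [Field F] (hF : ringChar F ≠ 2)
    (n : ℕ) (hn : 4 ≤ n) (heven : Even n)
    (G : Fin (n + 1) → FreeAlgebra F (Fin (n + 1)))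
    (hG : ∀ i, G i = (-1 : F) ^ (n / 2) •
      (altSum n (fun k => ι F (i.succAbove k)) + (-1 : F) ^ (n + (i : ℕ) + 1) • ι F i)) :
    LinearIndependent F
      (fun l : {l : List (Fin (n + 1)) // goodWord n l} =>
        RingQuot.mkAlgHom F (rel G) (mono F n l.1)) ∧
    Submodule.span F
      (Set.range fun l : {l : List (Fin (n + 1)) // goodWord n l} =>
        RingQuot.mkAlgHom F (rel G) (mono F n l.1)) = ⊤ ∧
    ¬ Module.Finite F (RingQuot (rel G)) := by
  have hsq : ((-1 : F) ^ (n / 2)) * ((-1 : F) ^ (n / 2)) = 1 := by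
    rw [← mul_pow]; simp
  obtain ⟨s, hs⟩ : ∃ s : F, s = ((Equiv.Perm.sign (Fin.revPerm : Equiv.Perm (Fin n)) : ℤ) : F) :=
    ⟨_, rfl⟩
  have hss : s * s = 1 := by
    rw [hs]
    rcases Int.units_eq_one_or (Equiv.Perm.sign (Fin.revPerm : Equiv.Perm (Fin n))) with h | h <;>
      simp [h]
  have hH := EnvBasis.good_of F n hn heven s (by rw [← hs]; exact hss)
    (fun i => s • (altSum n (fun k => ι F (i.succAbove k)) +
      (-1 : F) ^ (n + (i : ℕ) + 1) • ι F i)) (fun i => rfl)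
  refine EnvBasis.assembled hH (by omega) ?_ ?_
  · intro i
    have h1 := EnvBasis.H_mem_J (H := fun i => s • (altSum n (fun k => ι F (i.succAbove k)) +
      (-1 : F) ^ (n + (i : ℕ) + 1) • ι F i)) i
    have h2 := Submodule.smul_mem _ ((-1 : F) ^ (n / 2) * s) h1
    rw [hG i]
    convert h2 using 1
    simp only [smul_smul, mul_assoc, hss, mul_one]
  · intro i
    have h1 : RingQuot.mkAlgHom F (rel G) (G i) = 0 := by
      rw [RingQuot.mkAlgHom_rel F (s := rel G) (y := 0) ⟨i, rfl, rfl⟩, map_zero]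
    have h2 : s • (altSum n (fun k => ι F (i.succAbove k)) +
      (-1 : F) ^ (n + (i : ℕ) + 1) • ι F i) = (s * (-1 : F) ^ (n / 2)) • G i := by
      rw [hG i, smul_smul, mul_assoc, hsq, mul_one]
    simp only [h2, map_smul, h1, smul_zero]
end
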